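/- arXiv:2601.08769 — 2 statements merged into one kernel-verified Lean document; each statement's English description precedes it below -/
import Mathlib

section
/- Let G be an n-vertex graph such that every vertex subset S with |S| ≤ n/2 satisfies |N(S)| ≥ α|S| (an α-expander), with 0 < α < 1. Let X, Y, B be pairwise disjoint vertex sets with |X|, |Y| > 2|B|/α. Then there exists a path in G from X to Y that avoids all vertices of B and has length at most 2·log_{1+α/2}(n). -/
open Finset

/-- The external neighborhood of a finite vertex set `S` in `G`:
all vertices outside `S` adjacent to some vertex of `S`. -/
def extNbhd {V : Type*} (G : SimpleGraph V) [Fintype V] [DecidableEq V]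
    [DecidableRel G.Adj] (S : Finset V) : Finset V :=
  Finset.univ.filter fun v => v ∉ S ∧ ∃ u ∈ S, G.Adj u v

lemma exists_large_reach {V : Type*} (G : SimpleGraph V) [Fintype V] [DecidableEq V]
    [DecidableRel G.Adj] (α : ℝ) (hα0 : 0 < α)
    (hExp : ∀ S : Finset V, (S.card : ℝ) ≤ (Fintype.card V : ℝ) / 2 →
      α * S.card ≤ ((extNbhd G S).card : ℝ))
    (X B : Finset V) (hXB : Disjoint X B)
    (hX : 2 * (B.card : ℝ) / α < (X.card : ℝ)) :
    ∃ (R : Finset V) (k : ℕ), (1 + α / 2) ^ k ≤ (Fintype.card V : ℝ) ∧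
      (Fintype.card V : ℝ) / 2 < R.card ∧
      ∀ v ∈ R, ∃ x ∈ X, ∃ p : G.Walk x v, p.length ≤ k ∧ ∀ w ∈ p.support, w ∉ B := by
  by_contra hcon
  have key : ∀ k : ℕ, ∃ R : Finset V, X ⊆ R ∧ (1 + α / 2) ^ k ≤ (R.card : ℝ) ∧
      ∀ v ∈ R, ∃ x ∈ X, ∃ p : G.Walk x v, p.length ≤ k ∧ ∀ w ∈ p.support, w ∉ B := by
    intro k
    induction k with
    | zero =>
      refine ⟨X, subset_rfl, ?_, ?_⟩
      · have h0 : (0 : ℝ) < X.card := lt_of_le_of_lt (by positivity) hX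
        have h1 : 0 < X.card := by exact_mod_cast h0
        simpa using h1
      · intro v hv
        refine ⟨v, hv, SimpleGraph.Walk.nil, by simp, ?_⟩
        intro w hw
        have : w = v := by simpa using hw
        subst this
        exact Finset.disjoint_left.mp hXB hv
    | succ k ih =>
      obtain ⟨R, hXR, hcard, hR⟩ := ih
      have hle : (R.card : ℝ) ≤ (Fintype.card V : ℝ) / 2 := by
        by_contra hlt
        exact hcon ⟨R, k, hcard.trans (by exact_mod_cast Finset.card_le_univ R),
          not_le.mp hlt, hR⟩
      have hN := hExp R hle
      refine ⟨R ∪ (extNbhd G R \ B), hXR.trans Finset.subset_union_left, ?_, ?_⟩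
      · have hd : Disjoint R (extNbhd G R \ B) := by
          rw [Finset.disjoint_left]
          intro v hv hv2
          simp [extNbhd] at hv2
          exact hv2.1.1 hv
        rw [Finset.card_union_of_disjoint hd]
        have h1 : ((extNbhd G R).card : ℝ) ≤ (extNbhd G R \ B).card + B.card := by
          have := Finset.card_le_card_sdiff_add_card (t := B) (s := extNbhd G R)
          exact_mod_cast this
        have h2 : (X.card : ℝ) ≤ R.card := by exact_mod_cast Finset.card_le_card hXR
        rw [div_lt_iff₀ hα0] at hX
        have h3 : (1 + α / 2) ^ k * (1 + α / 2) ≤ R.card * (1 + α / 2) :=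
          mul_le_mul_of_nonneg_right hcard (by positivity)
        have h4 := mul_le_mul_of_nonneg_right h2 hα0.le
        rw [pow_succ]
        push_cast
        linarith
      · intro v hv
        rcases Finset.mem_union.mp hv with hv | hv
        · obtain ⟨x, hx, p, hp, hs⟩ := hR v hv
          exact ⟨x, hx, p, by omega, hs⟩
        · obtain ⟨hv1, hvB⟩ := Finset.mem_sdiff.mp hv
          simp only [extNbhd, Finset.mem_filter] at hv1
          obtain ⟨-, -, u, hu, huv⟩ := hv1
          obtain ⟨x, hx, p, hp, hs⟩ := hR u hu
          refine ⟨x, hx, p.concat huv, by simpa using hp, ?_⟩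
          intro w hw
          rw [SimpleGraph.Walk.support_concat] at hw
          have hw' : w ∈ p.support ∨ w = v := by simpa using hw
          rcases hw' with h | rfl
          · exact hs w h
          · exact hvB
  obtain ⟨k, hk⟩ := pow_unbounded_of_one_lt (Fintype.card V : ℝ)
    (show (1 : ℝ) < 1 + α / 2 by linarith)
  obtain ⟨R, -, h, -⟩ := key k
  have : (R.card : ℝ) ≤ Fintype.card V := by exact_mod_cast Finset.card_le_univ R
  linarith

/-- In an `α`-expander, between any two sets `X, Y` of size larger than `2|B|/α`
(`X, Y, B` pairwise disjoint) there is a path avoiding `B` of length at most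
`2 · log_{1+α/2} n`. -/
theorem stmt0 {V : Type*} (G : SimpleGraph V) [Fintype V] [DecidableEq V]
    [DecidableRel G.Adj] (α : ℝ) (hα0 : 0 < α) (hα1 : α < 1)
    (hExp : ∀ S : Finset V, (S.card : ℝ) ≤ (Fintype.card V : ℝ) / 2 →
      α * S.card ≤ ((extNbhd G S).card : ℝ))
    (X Y B : Finset V) (hXY : Disjoint X Y) (hXB : Disjoint X B) (hYB : Disjoint Y B)
    (hX : 2 * (B.card : ℝ) / α < (X.card : ℝ))
    (hY : 2 * (B.card : ℝ) / α < (Y.card : ℝ)) :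
    ∃ (x y : V) (p : G.Walk x y), x ∈ X ∧ y ∈ Y ∧ p.IsPath ∧
      (∀ v ∈ p.support, v ∉ B) ∧
      (p.length : ℝ) ≤ 2 * Real.logb (1 + α / 2) (Fintype.card V) := by
  obtain ⟨R, a, ha, hRc, hR⟩ := exists_large_reach G α hα0 hExp X B hXB hX
  obtain ⟨S, b, hb, hSc, hS⟩ := exists_large_reach G α hα0 hExp Y B hYB hY
  have hlog : ∀ k : ℕ, (1 + α / 2) ^ k ≤ (Fintype.card V : ℝ) →
      (k : ℝ) ≤ Real.logb (1 + α / 2) (Fintype.card V) := by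
    intro k hk
    have hpos : (0 : ℝ) < (1 + α / 2) ^ k := by positivity
    rw [Real.le_logb_iff_rpow_le (by linarith) (hpos.trans_le hk), Real.rpow_natCast]
    exact hk
  have hne : ¬ Disjoint R S := by
    intro hd
    have h1 := Finset.card_le_univ (R ∪ S)
    rw [Finset.card_union_of_disjoint hd] at h1
    have h2 : (R.card : ℝ) + S.card ≤ Fintype.card V := by exact_mod_cast h1
    linarith
  obtain ⟨v, hvR, hvS⟩ := Finset.not_disjoint_iff.mp hne
  obtain ⟨x, hx, p, hp, hpB⟩ := hR v hvR
  obtain ⟨y, hy, q, hq, hqB⟩ := hS v hvS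
  refine ⟨x, y, (p.append q.reverse).bypass, hx, hy, SimpleGraph.Walk.bypass_isPath _, ?_, ?_⟩
  · intro w hw
    have hw := SimpleGraph.Walk.support_bypass_subset_support _ hw
    rw [SimpleGraph.Walk.mem_support_append_iff] at hw
    rcases hw with h | h
    · exact hpB w h
    · exact hqB w (by simpa using h)
  · have h1 := SimpleGraph.Walk.length_bypass_le_length (p.append q.reverse)
    rw [SimpleGraph.Walk.length_append, SimpleGraph.Walk.length_reverse] at h1
    have h2 : ((p.append q.reverse).bypass.length : ℝ) ≤ a + b := by
      exact_mod_cast (by omega : (p.append q.reverse).bypass.length ≤ a + b)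
    have := hlog a ha
    have := hlog b hb
    linarith
end

section
/- Let G be a 2-connected graph containing a cycle C with two interlacing chords, and let C' be a cycle in G vertex-disjoint from C. Then G contains a cycle of length at least |C'|/2 that has at least one chord. -/
/-- Chord of a cycle. -/
def IsChord {V : Type*} (G : SimpleGraph V) {v : V} (c : G.Walk v v) (a b : V) : Prop :=
  G.Adj a b ∧ a ∈ c.support ∧ b ∈ c.support ∧ s(a, b) ∉ c.edges

/-- The four vertices `a, x, b, y` appear in this cyclic order along the cycle `c`. -/
def CyclicPattern {V : Type*} {G : SimpleGraph V} {v : V} (c : G.Walk v v)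
    (a x b y : V) : Prop :=
  ∃ l : List V, l.IsRotated c.support.tail ∧
    ∃ i j k m : ℕ, i < j ∧ j < k ∧ k < m ∧
      l[i]? = some a ∧ l[j]? = some x ∧ l[k]? = some b ∧ l[m]? = some y

/-- `G` is 2-connected: at least 3 vertices, and deleting any vertex leaves a
connected graph. -/
def TwoConnected {V : Type*} [Fintype V] (G : SimpleGraph V) : Prop :=
  3 ≤ Fintype.card V ∧ ∀ v : V, (G.induce {u : V | u ≠ v}).Connected

open SimpleGraph

section Aux
variable {V : Type*} {G : SimpleGraph V}

/-- Segment of a cycle between two indices. -/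
theorem aux_seg {v : V} (c : G.Walk v v) (hc : c.IsCycle) (i j : ℕ) (hij : i ≤ j)
    (hj : j ≤ c.length) (hn : j - i < c.length) :
    ∃ p : G.Walk (c.getVert i) (c.getVert j), p.IsPath ∧ p.length = j - i ∧ p.edges ⊆ c.edges ∧
      ∀ z, z ∈ p.support ↔ ∃ k, i ≤ k ∧ k ≤ j ∧ z = c.getVert k := by
  have he : (c.drop i).getVert (j - i) = c.getVert j := by
    rw [Walk.drop_getVert]; congr 1; omega
  refine ⟨((c.drop i).take (j - i)).copy rfl he, ?_, ?_, ?_, ?_⟩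
  · rw [Walk.isPath_copy]
    rcases Nat.eq_zero_or_pos i with rfl | hi
    · have h1 : (c.take j).IsPath := hc.isPath_take (by omega)
      rw [Walk.isPath_def, Walk.support_take] at h1 ⊢
      simpa using h1
    · exact (hc.isPath_drop hi).take _
  · simp; omega
  · intro e he
    rw [Walk.edges_copy, Walk.edges_take, Walk.edges_drop] at he
    exact List.mem_of_mem_drop (List.mem_of_mem_take he)
  · intro z
    rw [Walk.support_copy, Walk.mem_support_iff_exists_getVert]
    constructor
    · rintro ⟨k, hk, hk'⟩
      simp only [Walk.take_getVert, Walk.drop_getVert, Walk.take_length, Walk.drop_length] at hk hk'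
      exact ⟨i + k, by omega, by omega, by rw [← hk]; congr 1; omega⟩
    · rintro ⟨k, hk, hk', rfl⟩
      refine ⟨k - i, ?_, ?_⟩
      · simp only [Walk.take_getVert, Walk.drop_getVert]; congr 1; omega
      · simp only [Walk.take_length, Walk.drop_length]; omega

theorem aux_append {u v w : V} (p : G.Walk u v) (q : G.Walk v w) (hp : p.IsPath) (hq : q.IsPath)
    (h : ∀ z ∈ p.support, z ∈ q.support → z = v) : (p.append q).IsPath := by
  rw [Walk.isPath_def, Walk.support_append, List.nodup_append']
  refine ⟨hp.support_nodup, hq.support_nodup.tail, ?_⟩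
  intro z hz hz'
  have := h z hz (List.mem_of_mem_tail hz')
  subst this
  have hn := hq.support_nodup
  rw [← Walk.cons_tail_support] at hn
  exact (List.nodup_cons.mp hn).1 hz'

/-- Suffix after the last vertex in S. -/
theorem aux_last {u v : V} (p : G.Walk u v) (S : Set V) (h : ∃ z ∈ p.support, z ∈ S) :
    ∃ z ∈ S, ∃ q : G.Walk z v, q.support ⊆ p.support ∧ ∀ y ∈ q.support, y ∈ S → y = z := by
  induction p with
  | nil =>
    obtain ⟨z, hz, hzS⟩ := h
    simp at hz; subst hz
    exact ⟨z, hzS, Walk.nil, by simp, by simp⟩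
  | @cons a b d hab p ih =>
    by_cases h' : ∃ z ∈ p.support, z ∈ S
    · obtain ⟨z, hz, q, hq, hq'⟩ := ih h'
      exact ⟨z, hz, q, fun y hy => by simp [hq hy], hq'⟩
    · push Not at h'
      obtain ⟨z, hz, hzS⟩ := h
      rw [Walk.support_cons, List.mem_cons] at hz
      rcases hz with rfl | hz
      · refine ⟨z, hzS, Walk.cons hab p, fun y hy => hy, ?_⟩
        intro y hy hyS
        rw [Walk.support_cons, List.mem_cons] at hy
        rcases hy with rfl | hy
        · rfl
        · exact absurd hyS (h' y hy)
      · exact absurd hzS (h' z hz)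

theorem aux_first {u v : V} (p : G.Walk u v) (S : Set V) (h : ∃ z ∈ p.support, z ∈ S) :
    ∃ z ∈ S, ∃ q : G.Walk u z, q.support ⊆ p.support ∧ ∀ y ∈ q.support, y ∈ S → y = z := by
  obtain ⟨z, hz, q, hq, hq'⟩ := aux_last p.reverse S (by simpa using h)
  exact ⟨z, hz, q.reverse, fun y hy => by simpa using hq (by simpa using hy),
    fun y hy => hq' y (by simpa using hy)⟩

/-- Avoiding walks. -/
theorem aux_avoid (t : V) (h : (G.induce {u : V | u ≠ t}).Connected) (a b : V) (ha : a ≠ t)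
    (hb : b ≠ t) : ∃ p : G.Walk a b, t ∉ p.support := by
  obtain ⟨p⟩ := h.preconnected ⟨a, ha⟩ ⟨b, hb⟩
  refine ⟨p.map (Embedding.induce _).toHom, ?_⟩
  intro hm
  obtain ⟨z, -, hz⟩ := List.mem_map.mp (Walk.support_map _ p ▸ hm)
  exact z.2 hz

/-- Two disjoint walks from `A` to `t` and to `B`. -/
theorem aux_two (h : ∀ v : V, (G.induce {u : V | u ≠ v}).Connected) (A B : Set V)
    (hA : ∀ t, ∃ a ∈ A, a ≠ t) (hB : ∀ t, ∃ b ∈ B, b ≠ t) {s t : V} (r : G.Walk s t) (hs : s ∈ A) :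
    ∃ a₁ ∈ A, ∃ a₂ ∈ A, ∃ b ∈ B, ∃ X : G.Walk a₁ t, ∃ Y : G.Walk a₂ b,
      ∀ z ∈ X.support, z ∉ Y.support := by
  classical
  suffices H : ∀ {t s : V} (r : G.Walk t s), s ∈ A →
      ∃ a₁ ∈ A, ∃ a₂ ∈ A, ∃ b ∈ B, ∃ X : G.Walk a₁ t, ∃ Y : G.Walk a₂ b,
        ∀ z ∈ X.support, z ∉ Y.support from H r.reverse hs
  clear r hs s t
  intro t s r hs
  induction r with
  | @nil t =>
    obtain ⟨a, ha, hat⟩ := hA t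
    obtain ⟨b, hb, hbt⟩ := hB t
    obtain ⟨p, hp⟩ := aux_avoid t (h t) a b hat hbt
    exact ⟨t, hs, a, ha, b, hb, Walk.nil, p, by simpa using hp⟩
  | @cons t q s htq r ih =>
    obtain ⟨a₁, h₁, a₂, h₂, b, hb, X, Y, hXY⟩ := ih hs
    by_cases htX : t ∈ X.support
    · exact ⟨a₁, h₁, a₂, h₂, b, hb, X.takeUntil t htX, Y,
        fun z hz => hXY z (X.support_takeUntil_subset_support htX hz)⟩
    by_cases htY : t ∈ Y.support
    · obtain ⟨a, ha, hat⟩ := hA t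
      obtain ⟨b', hb', hbt⟩ := hB t
      obtain ⟨Z, hZ⟩ := aux_avoid t (h t) a b' hat hbt
      have hsub : (Y.takeUntil t htY).bypass.support ⊆ Y.support := fun z hz =>
        Y.support_takeUntil_subset_support htY (Walk.support_bypass_subset_support _ hz)
      have hpath := (Y.takeUntil t htY).bypass_isPath
      generalize (Y.takeUntil t htY).bypass = Y' at hsub hpath
      have hXY' : ∀ z ∈ X.support, z ∉ Y'.support := fun z hz hz' => hXY z hz (hsub hz')
      by_cases hm : ∃ z ∈ Z.support, z ∈ {z | z ∈ X.support ∨ z ∈ Y'.support}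
      · obtain ⟨z, hz, Z', hZ', hlast⟩ := aux_last Z _ hm
        have htZ' : t ∉ Z'.support := fun h => hZ (hZ' h)
        rcases hz with hz | hz
        · refine ⟨a₂, h₂, a₁, h₁, b', hb', Y', (X.takeUntil z hz).append Z', ?_⟩
          intro y hy hy'
          rw [Walk.mem_support_append_iff] at hy'
          rcases hy' with hy' | hy'
          · exact hXY' y (X.support_takeUntil_subset_support hz hy') hy
          · have := hlast y hy' (Or.inr hy)
            subst this
            exact hXY' y hz hy
        · refine ⟨a₁, h₁, a₂, h₂, b', hb', X.concat htq.symm, (Y'.takeUntil z hz).append Z', ?_⟩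
          have hzt : t ≠ z := fun h => htZ' (h ▸ Z'.start_mem_support)
          intro y hy hy'
          rw [Walk.mem_support_append_iff] at hy'
          rw [Walk.support_concat] at hy
          simp only [List.mem_append, List.mem_singleton] at hy
          rcases hy with hy | rfl
          · rcases hy' with hy' | hy'
            · exact hXY' y hy (Y'.support_takeUntil_subset_support hz hy')
            · have := hlast y hy' (Or.inl hy)
              subst this
              exact hXY' y hy hz
          · rcases hy' with hy' | hy'
            · exact Walk.endpoint_notMem_support_takeUntil hpath hz hzt hy'
            · exact htZ' hy'
      · push Not at hm
        exact ⟨a₂, h₂, a, ha, b', hb', Y', Z, fun y hy hy' => hm y hy' (Or.inr hy)⟩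
    · refine ⟨a₁, h₁, a₂, h₂, b, hb, X.concat htq.symm, Y, ?_⟩
      intro y hy
      rw [Walk.support_concat] at hy
      simp only [List.mem_append, List.mem_singleton] at hy
      rcases hy with hy | rfl
      · exact hXY y hy
      · exact htY


/-- The four vertices in order along a cycle starting at its base point. -/
theorem aux_chord_path {v w : V} (c : G.Walk v v) (hc : c.IsCycle) (hw : w ∈ c.support)
    (hne : v ≠ w) (i j k l : ℕ) (hi : 1 ≤ i) (hij : i < j) (hjk : j < k) (hkl : k < l)
    (hl : l ≤ c.length)
    (h1 : IsChord G c (c.getVert i) (c.getVert k)) (h2 : IsChord G c (c.getVert j) (c.getVert l)) :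
    ∃ Q : G.Walk v w, Q.IsPath ∧ Q.support ⊆ c.support ∧
      ∃ p q, G.Adj p q ∧ p ∈ Q.support ∧ q ∈ Q.support ∧ s(p, q) ∉ Q.edges := by
  obtain ⟨m, rfl, hm⟩ := Walk.mem_support_iff_exists_getVert.mp hw
  have h0 : c.getVert 0 = v := c.getVert_zero
  have hn : c.getVert c.length = v := c.getVert_length
  have hm0 : m ≠ 0 := fun h => hne (by rw [h, h0])
  have hmn : m ≠ c.length := fun h => hne (by rw [h, hn])
  have hsub : ∀ {a b : V} (p : G.Walk a b) (i j : ℕ),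
      (∀ z, z ∈ p.support ↔ ∃ k, i ≤ k ∧ k ≤ j ∧ z = c.getVert k) → p.support ⊆ c.support := by
    intro a b p i j hp z hz
    obtain ⟨k, -, -, rfl⟩ := (hp z).1 hz
    exact c.getVert_mem_support k
  -- the two arcs
  obtain ⟨A, hA, -, hAe, hAs⟩ := aux_seg c hc 0 m (by omega) (by omega) (by omega)
  obtain ⟨B, hB, -, hBe, hBs⟩ := aux_seg c hc m c.length (by omega) (by omega) (by omega)
  have useA : ∀ i k, i ≤ m → k ≤ m → IsChord G c (c.getVert i) (c.getVert k) →
      ∃ Q : G.Walk v (c.getVert m), Q.IsPath ∧ Q.support ⊆ c.support ∧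
      ∃ p q, G.Adj p q ∧ p ∈ Q.support ∧ q ∈ Q.support ∧ s(p, q) ∉ Q.edges := by
    intro i k hi hk h
    refine ⟨A.copy h0 rfl, by simpa using hA, by simpa using hsub A _ _ hAs,
      c.getVert i, c.getVert k, h.1, ?_, ?_, ?_⟩
    · rw [Walk.support_copy, hAs]; exact ⟨i, by omega, hi, rfl⟩
    · rw [Walk.support_copy, hAs]; exact ⟨k, by omega, hk, rfl⟩
    · rw [Walk.edges_copy]; exact fun h' => h.2.2.2 (hAe h')
  by_cases c1 : k ≤ m
  · exact useA i k (by omega) c1 h1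
  by_cases c2 : m ≤ j
  · refine ⟨B.reverse.copy hn rfl, by simpa using hB, by simpa using hsub B _ _ hBs,
      c.getVert j, c.getVert l, h2.1, ?_, ?_, ?_⟩
    · rw [Walk.support_copy, Walk.support_reverse, List.mem_reverse, hBs]
      exact ⟨j, by omega, by omega, rfl⟩
    · rw [Walk.support_copy, Walk.support_reverse, List.mem_reverse, hBs]
      exact ⟨l, by omega, by omega, rfl⟩
    · rw [Walk.edges_copy, Walk.edges_reverse, List.mem_reverse]
      exact fun h' => h2.2.2.2 (hBe h')
  by_cases c3 : l = c.length
  · refine useA j 0 (by omega) (by omega) ?_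
    have e : c.getVert 0 = c.getVert l := by rw [c3, h0, hn]
    rwa [e]
  obtain ⟨P, hP, -, hPe, hPs⟩ := aux_seg c hc 0 j (by omega) (by omega) (by omega)
  obtain ⟨R, hR, -, hRe, hRs⟩ := aux_seg c hc m l (by omega) (by omega) (by omega)
  have inj : ∀ s t, s < c.length → t < c.length → c.getVert s = c.getVert t → s = t := by
    intro s t hs ht h
    exact hc.getVert_injOn' (by simp; omega) (by simp; omega) h
  have hPR : ∀ z ∈ P.support, z ∉ R.support := by
    intro z hz hz'
    obtain ⟨s, hs, hs', rfl⟩ := (hPs z).1 hz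
    obtain ⟨t, ht, ht', h⟩ := (hRs _).1 hz'
    have := inj s t (by omega) (by omega) h
    omega
  have hR' : (Walk.cons h2.1 R.reverse).IsPath := by
    refine hR.reverse.cons ?_
    rw [Walk.support_reverse, List.mem_reverse]
    exact hPR _ P.end_mem_support
  refine ⟨(P.append (Walk.cons h2.1 R.reverse)).copy h0 rfl, ?_, ?_,
    c.getVert i, c.getVert k, h1.1, ?_, ?_, ?_⟩
  · rw [Walk.isPath_copy]
    refine aux_append _ _ hP hR' ?_
    intro z hz hz'
    rw [Walk.support_cons, Walk.support_reverse, List.mem_cons, List.mem_reverse] at hz'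
    rcases hz' with h | h
    · exact h
    · exact absurd h (hPR z hz)
  · intro z hz
    rw [Walk.support_copy, Walk.mem_support_append_iff, Walk.support_cons, Walk.support_reverse,
      List.mem_cons, List.mem_reverse] at hz
    rcases hz with h | h | h
    · exact hsub P _ _ hPs h
    · rw [h]; exact c.getVert_mem_support _
    · exact hsub R _ _ hRs h
  · rw [Walk.support_copy, Walk.mem_support_append_iff, hPs]
    exact Or.inl ⟨i, by omega, by omega, rfl⟩
  · rw [Walk.support_copy, Walk.mem_support_append_iff, Walk.support_cons, Walk.support_reverse,
      List.mem_cons, List.mem_reverse, hRs]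
    exact Or.inr (Or.inr ⟨k, by omega, by omega, rfl⟩)
  · rw [Walk.edges_copy, Walk.edges_append, Walk.edges_cons, Walk.edges_reverse, List.mem_append,
      List.mem_cons, List.mem_reverse]
    rintro (h | h | h)
    · exact h1.2.2.2 (hPe h)
    · rw [Sym2.eq_iff] at h
      rcases h with h | h
      · have := inj _ _ (by omega) (by omega) h.1
        omega
      · have := inj _ _ (by omega) (by omega) h.1
        omega
    · exact h1.2.2.2 (hRe h)

theorem aux_chord_symm {v : V} {c : G.Walk v v} {a b : V} (h : IsChord G c a b) :
    IsChord G c b a :=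
  ⟨h.1.symm, h.2.2.1, h.2.1, by rw [Sym2.eq_swap]; exact h.2.2.2⟩

theorem aux_chord_rotate {v u : V} {c : G.Walk v v} [DecidableEq V] (hu : u ∈ c.support) {a b : V}
    (h : IsChord G c a b) : IsChord G (c.rotate u hu) a b :=
  ⟨h.1, (c.mem_support_rotate_iff u hu).2 h.2.1, (c.mem_support_rotate_iff u hu).2 h.2.2.1,
    fun h' => h.2.2.2 ((c.rotate_edges u hu).mem_iff.1 h')⟩

theorem aux_chord_path_pattern {v w : V} (c : G.Walk v v) (hc : c.IsCycle) (hw : w ∈ c.support)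
    (hne : v ≠ w) (a b x y : V) (hab : IsChord G c a b) (hxy : IsChord G c x y)
    (hint : CyclicPattern c a x b y) :
    ∃ Q : G.Walk v w, Q.IsPath ∧ Q.support ⊆ c.support ∧
      ∃ p q, G.Adj p q ∧ p ∈ Q.support ∧ q ∈ Q.support ∧ s(p, q) ∉ Q.edges := by
  obtain ⟨l, hl, i, j, k, m, hij, hjk, hkm, ha, hx, hb, hy⟩ := hint
  obtain ⟨r, hr, rfl⟩ := List.isRotated_iff_mod.1 hl.symm
  have hlen : c.support.tail.length = c.length := by simp
  have hmn : m < c.length := by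
    have := (List.getElem?_eq_some_iff.1 hy).1
    simpa using this
  rw [hlen] at hr
  -- translate positions
  have key : ∀ i z, i < c.length → (c.support.tail.rotate r)[i]? = some z →
      (i + r < c.length ∧ c.getVert (i + r + 1) = z) ∨
      (c.length ≤ i + r ∧ c.getVert (i + r - c.length + 1) = z) := by
    intro i z hi h
    rw [List.getElem?_rotate (by omega), hlen, List.getElem?_tail] at h
    rcases lt_or_ge (i + r) c.length with h' | h'
    · left
      rw [Nat.mod_eq_of_lt h', ← Walk.getVert_eq_support_getElem? _ (by omega)] at h
      exact ⟨h', by simpa using h⟩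
    · right
      rw [Nat.mod_eq_sub_mod h', Nat.mod_eq_of_lt (by omega),
        ← Walk.getVert_eq_support_getElem? _ (by omega)] at h
      exact ⟨h', by simpa using h⟩
  have hba := aux_chord_symm hab
  have hyx := aux_chord_symm hxy
  have main := aux_chord_path c hc hw hne
  rcases key i a (by omega) ha with ⟨h1, rfl⟩ | ⟨h1, rfl⟩
  · rcases key j x (by omega) hx with ⟨h2, rfl⟩ | ⟨h2, rfl⟩
    · rcases key k b (by omega) hb with ⟨h3, rfl⟩ | ⟨h3, rfl⟩
      · rcases key m y (by omega) hy with ⟨h4, rfl⟩ | ⟨h4, rfl⟩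
        · exact main _ _ _ _ (by omega) (by omega) (by omega) (by omega) (by omega) hab hxy
        · exact main _ _ _ _ (by omega) (by omega) (by omega) (by omega) (by omega) hyx hab
      · rcases key m y (by omega) hy with ⟨h4, rfl⟩ | ⟨h4, rfl⟩
        · omega
        · exact main _ _ _ _ (by omega) (by omega) (by omega) (by omega) (by omega) hba hyx
    · rcases key k b (by omega) hb with ⟨h3, rfl⟩ | ⟨h3, rfl⟩
      · omega
      rcases key m y (by omega) hy with ⟨h4, rfl⟩ | ⟨h4, rfl⟩
      · omega
      exact main _ _ _ _ (by omega) (by omega) (by omega) (by omega) (by omega) hxy hba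
  · rcases key j x (by omega) hx with ⟨h2, rfl⟩ | ⟨h2, rfl⟩
    · omega
    rcases key k b (by omega) hb with ⟨h3, rfl⟩ | ⟨h3, rfl⟩
    · omega
    rcases key m y (by omega) hy with ⟨h4, rfl⟩ | ⟨h4, rfl⟩
    · omega
    exact main _ _ _ _ (by omega) (by omega) (by omega) (by omega) (by omega) hab hxy

/-- The long arc. -/
theorem aux_long {v w : V} (c : G.Walk v v) (hc : c.IsCycle) (hw : w ∈ c.support)
    (hne : v ≠ w) : ∃ L : G.Walk v w, L.IsPath ∧ L.support ⊆ c.support ∧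
      c.length ≤ 2 * L.length := by
  obtain ⟨m, rfl, hm⟩ := Walk.mem_support_iff_exists_getVert.mp hw
  have h0 : c.getVert 0 = v := c.getVert_zero
  have hn : c.getVert c.length = v := c.getVert_length
  have hm0 : m ≠ 0 := fun h => hne (by rw [h, h0])
  have hmn : m ≠ c.length := fun h => hne (by rw [h, hn])
  obtain ⟨A, hA, hAl, -, hAs⟩ := aux_seg c hc 0 m (by omega) (by omega) (by omega)
  obtain ⟨B, hB, hBl, -, hBs⟩ := aux_seg c hc m c.length (by omega) (by omega) (by omega)
  by_cases h : c.length ≤ 2 * m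
  · refine ⟨A.copy h0 rfl, by simpa using hA, ?_, by simp; omega⟩
    intro z hz
    rw [Walk.support_copy, hAs] at hz
    obtain ⟨k, -, -, rfl⟩ := hz
    exact c.getVert_mem_support k
  · refine ⟨B.reverse.copy hn rfl, by simpa using hB, ?_, by simp; omega⟩
    intro z hz
    rw [Walk.support_copy, Walk.support_reverse, List.mem_reverse, hBs] at hz
    obtain ⟨k, -, -, rfl⟩ := hz
    exact c.getVert_mem_support k

/-- Trim a walk from `A` to `B`. -/
theorem aux_trim {A B : Set V} {a b : V} (X : G.Walk a b) (ha : a ∈ A) (hb : b ∈ B) :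
    ∃ a' ∈ A, ∃ b' ∈ B, ∃ P : G.Walk a' b', P.IsPath ∧ P.support ⊆ X.support ∧
      (∀ z ∈ P.support, z ∈ A → z = a') ∧ (∀ z ∈ P.support, z ∈ B → z = b') := by
  classical
  obtain ⟨a', ha', X', h1, h2⟩ := aux_last X A ⟨a, X.start_mem_support, ha⟩
  obtain ⟨b', hb', X'', h3, h4⟩ := aux_first X' B ⟨b, X'.end_mem_support, hb⟩
  exact ⟨a', ha', b', hb', X''.bypass, X''.bypass_isPath,
    fun z hz => h1 (h3 (X''.support_bypass_subset_support hz)),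
    fun z hz => h2 z (h3 (X''.support_bypass_subset_support hz)),
    fun z hz => h4 z (X''.support_bypass_subset_support hz)⟩

theorem aux_other {v : V} (c : G.Walk v v) (hc : c.IsCycle) (t : V) : ∃ a ∈ c.support, a ≠ t := by
  by_contra h
  push Not at h
  have h3 := hc.three_le_length
  have := hc.getVert_injOn' (x₁ := 0) (x₂ := 1) (by simp) (by simp; omega)
    (by rw [h _ (c.getVert_mem_support 0), h _ (c.getVert_mem_support 1)])
  omega

end Aux

/-- If a 2-connected graph `G` has a cycle with two interlacing chords, and another
cycle `C'` vertex-disjoint from it, then `G` has a chorded cycle of length at least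
`|C'|/2`. -/
theorem stmt4 {V : Type*} [Fintype V] (G : SimpleGraph V)
    (h2c : TwoConnected G)
    {v w : V} (c : G.Walk v v) (hc : c.IsCycle)
    (a b x y : V) (hab : IsChord G c a b) (hxy : IsChord G c x y)
    (hint : CyclicPattern c a x b y)
    (c' : G.Walk w w) (hc' : c'.IsCycle)
    (hdisj : ∀ z ∈ c.support, z ∉ c'.support) :
    ∃ (u : V) (d : G.Walk u u), d.IsCycle ∧ c'.length ≤ 2 * d.length ∧
      ∃ p q : V, IsChord G d p q := by
  classical
  have hwv : ∃ r : G.Walk w v, True := by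
    obtain ⟨t, ht, ht'⟩ : ∃ t, t ≠ w ∧ t ≠ v := by
      obtain ⟨t, ht⟩ : ∃ t, t ∉ ({w, v} : Finset V) := by
        by_contra h
        push Not at h
        have h1 := h2c.1
        have h2 : (Finset.univ : Finset V).card ≤ ({w, v} : Finset V).card :=
          Finset.card_le_card fun z _ => h z
        have h3 := Finset.card_le_two (a := w) (b := v)
        rw [Finset.card_univ] at h2
        omega
      simp only [Finset.mem_insert, Finset.mem_singleton, not_or] at ht
      exact ⟨t, ht⟩
    obtain ⟨p, -⟩ := aux_avoid t (h2c.2 t) w v ht.symm ht'.symm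
    exact ⟨p, trivial⟩
  obtain ⟨r, -⟩ := hwv
  obtain ⟨a₁, ha₁, a₂, ha₂, b₂, hb₂, X₀, Y₀, hXY₀⟩ := aux_two h2c.2 {z | z ∈ c'.support}
    {z | z ∈ c.support} (aux_other c' hc') (aux_other c hc) r c'.start_mem_support
  obtain ⟨p₁, hp₁, q₁, hq₁, X, hX, hXs, hXA, hXB⟩ :=
    aux_trim (B := {z | z ∈ c.support}) X₀ ha₁ c.start_mem_support
  obtain ⟨p₂, hp₂, q₂, hq₂, Y, hY, hYs, hYA, hYB⟩ := aux_trim Y₀ ha₂ hb₂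
  have hXY : ∀ z ∈ X.support, z ∉ Y.support := fun z hz hz' => hXY₀ z (hXs hz) (hYs hz')
  simp only [Set.mem_ofPred_eq] at hp₁ hq₁ hp₂ hq₂ hXA hXB hYA hYB
  have hpne : p₁ ≠ p₂ := fun h => hXY _ X.start_mem_support (h ▸ Y.start_mem_support)
  have hqne : q₁ ≠ q₂ := fun h => hXY _ X.end_mem_support (h ▸ Y.end_mem_support)
  obtain ⟨L, hL, hLs, hLl⟩ := aux_long (c'.rotate p₁ hp₁)
    ((Walk.isCycle_rotate hp₁).2 hc') ((c'.mem_support_rotate_iff p₁ hp₁).2 hp₂) hpne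
  obtain ⟨Q, hQ, hQs, p, q, hpq, hpQ, hqQ, hpqe⟩ := aux_chord_path_pattern (c.rotate q₁ hq₁)
    ((Walk.isCycle_rotate hq₁).2 hc) ((c.mem_support_rotate_iff q₁ hq₁).2 hq₂) hqne a b x y
    (aux_chord_rotate hq₁ hab) (aux_chord_rotate hq₁ hxy) (by
      obtain ⟨l, hl, h⟩ := hint
      exact ⟨l, hl.trans (c.support_rotate q₁ hq₁).symm, h⟩)
  rw [Walk.length_rotate] at hLl
  replace hLs : ∀ z ∈ L.support, z ∈ c'.support :=
    fun z hz => (c'.mem_support_rotate_iff p₁ hp₁).1 (hLs hz)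
  replace hQs : ∀ z ∈ Q.support, z ∈ c.support :=
    fun z hz => (c.mem_support_rotate_iff q₁ hq₁).1 (hQs hz)
  have hLY : (L.append Y).IsPath := aux_append _ _ hL hY fun z hz hz' => hYA z hz' (hLs z hz)
  have hLYQ : ((L.append Y).append Q.reverse).IsPath := by
    refine aux_append _ _ hLY hQ.reverse fun z hz hz' => ?_
    rw [Walk.support_reverse, List.mem_reverse] at hz'
    rw [Walk.mem_support_append_iff] at hz
    rcases hz with hz | hz
    · exact absurd (hLs z hz) (hdisj z (hQs z hz'))
    · exact hYB z hz (hQs z hz')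
  have hYpos : 0 < Y.length := by
    rcases Nat.eq_zero_or_pos Y.length with h | h
    · have := Walk.eq_of_length_eq_zero h
      exact absurd hp₂ (hdisj _ (this ▸ hq₂))
    · exact h
  have hQpos : 0 < Q.length := by
    rcases Nat.eq_zero_or_pos Q.length with h | h
    · exact absurd (Walk.eq_of_length_eq_zero h) hqne
    · exact h
  have hnot : ∀ {s t : V} (P : G.Walk s t) (S : List V) (e : V),
      (∀ z ∈ P.support, z ∈ S → z = e) → p ∈ S → q ∈ S → s(p, q) ∉ P.edges := by
    intro s t P S e h hp hq he
    have h1 := h p (P.fst_mem_support_of_mem_edges he) hp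
    have h2 := h q (P.snd_mem_support_of_mem_edges he) hq
    exact hpq.ne (h1.trans h2.symm)
  refine ⟨p₁, ((L.append Y).append Q.reverse).append X.reverse, ?_, ?_, p, q, hpq, ?_, ?_, ?_⟩
  · refine hLYQ.isCycle_append hX.reverse ?_ (Or.inl ?_)
    · intro z hz hz'
      have hz1 := List.mem_of_mem_tail hz
      have hz2 := List.mem_of_mem_tail hz'
      have hn1 := hLYQ.support_nodup
      rw [← Walk.cons_tail_support] at hn1
      have hn2 := hX.reverse.support_nodup
      rw [← Walk.cons_tail_support] at hn2
      have hne1 : z ≠ p₁ := fun h => (List.nodup_cons.1 hn1).1 (h ▸ hz)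
      have hne2 : z ≠ q₁ := fun h => (List.nodup_cons.1 hn2).1 (h ▸ hz')
      rw [Walk.support_reverse, List.mem_reverse] at hz2
      rw [Walk.mem_support_append_iff, Walk.mem_support_append_iff, Walk.support_reverse,
        List.mem_reverse] at hz1
      rcases hz1 with (h | h) | h
      · exact hne1 (hXA z hz2 (hLs z h))
      · exact hXY z hz2 h
      · exact hne2 (hXB z hz2 (hQs z h))
    · simp only [Walk.length_append, Walk.length_reverse]; omega
  · simp only [Walk.length_append, Walk.length_reverse]; omega
  · simp [hpQ]
  · simp [hqQ]
  · simp only [Walk.edges_append, Walk.edges_reverse, List.mem_append, List.mem_reverse, not_or]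
    refine ⟨⟨⟨?_, ?_⟩, hpqe⟩, ?_⟩
    · exact hnot L c.support w (fun z hz hz' => absurd (hLs z hz) (hdisj z hz')) (hQs p hpQ)
        (hQs q hqQ)
    · exact hnot Y c.support q₂ hYB (hQs p hpQ) (hQs q hqQ)
    · exact hnot X c.support q₁ hXB (hQs p hpQ) (hQs q hqQ)
end
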